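/- Let q be the probability density on the circle proportional to exp(-W), where W : S¹ → ℝ is C² with W'' ≤ M̄ = 8C̄(k+1) and W attains its minimum at t_min, and suppose the lower bound W(t_min) ≤ W(t) ≤ W(t_min) + M̄|t-t_min|² holds. Then sup_t q(t) ≤ C₁√(k+1) for a constant C₁ depending only on C̄. -/

import Mathlib

open Real MeasureTheory

/-- The distance from `t` to `s` on the circle of length `2π` is at most `|t - s|`. -/
lemma iInf_abs_sub_two_pi_mul_le (t s : ℝ) :
    ⨅ m : ℤ, |t - s - 2 * π * m| ≤ |t - s| := by
  have hbdd : BddBelow (Set.range fun m : ℤ => |t - s - 2 * π * m|) :=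
    ⟨0, by rintro _ ⟨m, rfl⟩; exact abs_nonneg _⟩
  simpa using ciInf_le hbdd 0

/-- A nonnegative continuous periodic function bounded below by `c` on `[a, a + r]`, with `r` at
most one period `T`, has integral at least `r * c` over a period. -/
lemma Function.Periodic.mul_le_intervalIntegral {f : ℝ → ℝ} {T a r c : ℝ}
    (hper : Function.Periodic f T) (hf : Continuous f) (hnonneg : ∀ t, 0 ≤ f t)
    (hr : 0 ≤ r) (hrT : r ≤ T) (hc : ∀ t ∈ Set.Icc a (a + r), c ≤ f t) :
    r * c ≤ ∫ t in (0 : ℝ)..T, f t := by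
  calc
    r * c = ∫ _ in a..(a + r), c := by simp
    _ ≤ ∫ t in a..(a + r), f t :=
      intervalIntegral.integral_mono_on (by linarith) (by simp)
        (hf.intervalIntegrable _ _) hc
    _ ≤ ∫ t in a..(a + T), f t :=
      intervalIntegral.integral_mono_interval le_rfl (by linarith) (by linarith)
        (Filter.Eventually.of_forall hnonneg) (hf.intervalIntegrable _ _)
    _ = ∫ t in (0 : ℝ)..T, f t := by
      simpa using hper.intervalIntegral_add_eq a 0

/-- if `W` is continuous, `2π`-periodic and satisfies
`W(t_min) ≤ W(t) ≤ W(t_min) + 8 C̄ (k+1) d(t,t_min)²`, then the Gibbs density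
`q = e^{-W} / ∫ e^{-W}` satisfies `sup q ≤ C₁ √(k+1)` with `C₁` depending only on `C̄`. -/
theorem gibbs_density_sup_bound :
    ∀ Cbar : ℝ, 0 < Cbar → ∃ C₁ : ℝ, 0 < C₁ ∧
      ∀ (k : ℕ) (W : ℝ → ℝ) (tmin : ℝ),
        Function.Periodic W (2 * π) → Continuous W →
        (∀ t, W tmin ≤ W t) →
        (∀ t, W t ≤ W tmin + 8 * Cbar * (k + 1) *
          (⨅ m : ℤ, |t - tmin - 2 * π * m|) ^ 2) →
        ∀ t, Real.exp (-W t) / (∫ s' in (0:ℝ)..(2 * π), Real.exp (-W s')) ≤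
          C₁ * Real.sqrt (k + 1) := by
  intro C hC
  refine ⟨Real.exp (8 * C), Real.exp_pos _, ?_⟩
  intro k W tmin hper hcont hmin hupper t
  have hk : (1 : ℝ) ≤ k + 1 := by simp
  set R : ℝ := Real.sqrt (k + 1) with hR
  have hR1 : 1 ≤ R := Real.one_le_sqrt.mpr hk
  have hR0 : 0 < R := by linarith
  have hRsq : R ^ 2 = k + 1 := Real.sq_sqrt (by linarith)
  have hlower : ∀ s ∈ Set.Icc tmin (tmin + R⁻¹),
      Real.exp (-W tmin - 8 * C) ≤ Real.exp (-W s) := by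
    intro s hs
    have hdist : ⨅ m : ℤ, |s - tmin - 2 * π * m| ≤ R⁻¹ :=
      (iInf_abs_sub_two_pi_mul_le s tmin).trans
        (abs_le.mpr ⟨by linarith [hs.1, inv_pos.mpr hR0], by linarith [hs.2]⟩)
    have hquad : 8 * C * (k + 1) * (⨅ m : ℤ, |s - tmin - 2 * π * m|) ^ 2 ≤ 8 * C := by
      calc
        _ ≤ 8 * C * (k + 1) * (R⁻¹) ^ 2 := by
          gcongr
          exact Real.iInf_nonneg fun _ => abs_nonneg _
        _ = 8 * C := by rw [← hRsq]; field_simp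
    exact Real.exp_le_exp.mpr (by linarith [hupper s])
  have hint : R⁻¹ * Real.exp (-W tmin - 8 * C) ≤
      ∫ s in (0 : ℝ)..(2 * π), Real.exp (-W s) :=
    Function.Periodic.mul_le_intervalIntegral (fun s => by simp only [hper s])
      (by fun_prop) (fun _ => (Real.exp_pos _).le) (by positivity)
      (by linarith [inv_le_one_of_one_le₀ hR1, Real.pi_gt_three]) hlower
  have hpos : 0 < R⁻¹ * Real.exp (-W tmin - 8 * C) := by positivity
  rw [div_le_iff₀ (hpos.trans_le hint)]
  calc
    Real.exp (-W t) ≤ Real.exp (-W tmin) := Real.exp_le_exp.mpr (by linarith [hmin t])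
    _ = Real.exp (8 * C) * R * (R⁻¹ * Real.exp (-W tmin - 8 * C)) := by
      rw [Real.exp_sub]; field_simp
    _ ≤ _ := by gcongr
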